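/- Let G = (V, E, (V_0, V_1, V_r)) be a 2½-player game graph and B, T ⊆ V, with B^c := V∖B. Let Y* be the value of the nested fixpoint νY. μX. (B^c ∩ Apre(Y, X)) ∪ (B ∩ Cpre(Y)) ∪ T. Then every vertex v ∈ V for which there exists π_0 ∈ Π_0 such that for all π_1 ∈ Π_1, P_v^{π_0,π_1}((□◇B) ∪ (◇T)) = 1, belongs to Y*. -/

import Mathlib

open MeasureTheory
open scoped ENNReal

/-- A 2½-player game graph: a finite set of vertices `V`, an edge relation `E`, and a
partition of `V` into Player-0 vertices `V0`, Player-1 vertices `V1` and random vertices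
`Vr` (the partition and nonemptiness conditions are stated via `IsGameGraph`). -/
structure GameGraph (V : Type*) where
  E : V → Set V
  V0 : Set V
  V1 : Set V
  Vr : Set V

/-- The defining conditions of a 2½-player game graph: every vertex has a successor and
`(V0, V1, Vr)` is a partition of `V`. -/
def GameGraph.IsGameGraph {V : Type*} (G : GameGraph V) : Prop :=
  (∀ v, (G.E v).Nonempty) ∧ G.V0 ∪ G.V1 ∪ G.Vr = Set.univ ∧
    Disjoint G.V0 G.V1 ∧ Disjoint G.V0 G.Vr ∧ Disjoint G.V1 G.Vr

/-- A (randomized, history-dependent) strategy: it assigns to every history `h ∈ V*` and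
current vertex `v` a probability distribution supported on the successors `E(v)`. -/
def IsStrategy {V : Type*} (G : GameGraph V) (σ : List V → V → PMF V) : Prop :=
  ∀ (h : List V) (v : V), (σ h v).support ⊆ G.E v

/-- Deterministic memoryless strategies. -/
def IsDM {V : Type*} (σ : List V → V → PMF V) : Prop :=
  ∃ f : V → V, ∀ (h : List V) (v : V), σ h v = PMF.pure (f v)

open scoped Classical in
/-- One-step transition probability: at a Player-0 vertex `π0` moves, at a Player-1 vertex
`π1` moves, and at a random vertex the successor is drawn uniformly at random from `E(v)`. -/
noncomputable def stepProb {V : Type*} (G : GameGraph V)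
    (π0 π1 : List V → V → PMF V) (h : List V) (v x : V) : ℝ≥0∞ :=
  if v ∈ G.V0 then π0 h v x
  else if v ∈ G.V1 then π1 h v x
  else if x ∈ G.E v then ((G.E v).ncard : ℝ≥0∞)⁻¹ else 0

/-- Probability that, starting at vertex `v` with past history `h`, the run continues with
the finite sequence of vertices `l`. -/
noncomputable def extProb {V : Type*} (G : GameGraph V)
    (π0 π1 : List V → V → PMF V) : List V → V → List V → ℝ≥0∞
  | _, _, [] => 1
  | h, v, x :: rest => stepProb G π0 π1 h v x * extProb G π0 π1 (h ++ [v]) x rest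

open scoped Classical in
/-- Probability that the run started at `v` begins with the finite sequence `l`. -/
noncomputable def prefixProb {V : Type*} (G : GameGraph V)
    (π0 π1 : List V → V → PMF V) (v : V) : List V → ℝ≥0∞
  | [] => 1
  | x :: rest => if x = v then extProb G π0 π1 [] v rest else 0

/-- The cylinder set of runs beginning with the finite word `l`. -/
def cyl {V : Type*} (l : List V) : Set (ℕ → V) :=
  {r | ∀ i : Fin l.length, r i = l.get i}

/-- `P` is the probability measure `P_v^{π0,π1}` on the run space `V^ℕ` (obtained by the
Ionescu–Tulcea construction): it is a probability measure whose cylinder probabilities are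
the finite-run probabilities determined by `π0`, `π1` and the uniform choices at random
vertices. -/
def IsRunMeasure {V : Type*} [MeasurableSpace V] (G : GameGraph V)
    (π0 π1 : List V → V → PMF V) (v : V) (P : Measure (ℕ → V)) : Prop :=
  IsProbabilityMeasure P ∧ ∀ l : List V, P (cyl l) = prefixProb G π0 π1 v l

/-- Controllable predecessor. -/
def Cpre {V : Type*} (G : GameGraph V) (C : Set V) : Set V :=
  {v ∈ G.V0 | (G.E v ∩ C).Nonempty} ∪ {v ∈ G.V1 ∪ G.Vr | G.E v ⊆ C}

/-- Almost-sure predecessor. -/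
def Apre {V : Type*} (G : GameGraph V) (C D : Set V) : Set V :=
  Cpre G D ∪ {v ∈ G.Vr | G.E v ⊆ C ∧ (G.E v ∩ D).Nonempty}

/-- Least fixed point (Knaster–Tarski) of an operator on sets of vertices. -/
def lfpSet {V : Type*} (f : Set V → Set V) : Set V := sInf {A | f A ⊆ A}

/-- Greatest fixed point (Knaster–Tarski) of an operator on sets of vertices. -/
def gfpSet {V : Type*} (f : Set V → Set V) : Set V := sSup {A | A ⊆ f A}

inductive Reach {V : Type*} (G : GameGraph V) (T : Set V) (π0 : List V → V → PMF V) (v : V) :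
    List V → V → Prop
  | base : Reach G T π0 v [] v
  | step {h : List V} {u x : V} : Reach G T π0 v h u → u ∉ T →
      (u ∈ G.V0 → x ∈ (π0 h u).support) → (u ∉ G.V0 → x ∈ G.E u) →
      Reach G T π0 v (h ++ [u]) x

theorem extProb_snoc {V : Type*} (G : GameGraph V) (π0 π1 : List V → V → PMF V)
    (l : List V) : ∀ (h : List V) (v u x : V),
    extProb G π0 π1 h v (l ++ [u] ++ [x]) =
      extProb G π0 π1 h v (l ++ [u]) * stepProb G π0 π1 (h ++ v :: l) u x := by
  induction l with
  | nil => intro h v u x; simp [extProb]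
  | cons a l ih =>
    intro h v u x
    have := ih (h ++ [v]) a u x
    simp only [List.cons_append, extProb, List.append_assoc] at this ⊢
    rw [this, mul_assoc]
    simp

theorem prefixProb_snoc {V : Type*} (G : GameGraph V) (π0 π1 : List V → V → PMF V)
    (v : V) (h : List V) (u x : V) :
    prefixProb G π0 π1 v (h ++ [u] ++ [x]) =
      prefixProb G π0 π1 v (h ++ [u]) * stepProb G π0 π1 h u x := by
  cases h with
  | nil =>
    by_cases hu : u = v
    · subst hu; simp [prefixProb, extProb]
    · simp [prefixProb, hu]
  | cons a l =>
    by_cases ha : a = v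
    · subst ha
      have := extProb_snoc G π0 π1 l [] a u x
      simpa [prefixProb] using this
    · simp [prefixProb, ha]

theorem Reach.notMem {V : Type*} {G : GameGraph V} {T : Set V} {π0 : List V → V → PMF V} {v : V}
    {h : List V} {u : V} (H : Reach G T π0 v h u) : ∀ y ∈ h, y ∉ T := by
  induction H with
  | base => simp
  | step _ hT _ _ ih =>
    intro y hy
    rcases List.mem_append.1 hy with hy | hy
    · exact ih y hy
    · simp at hy; subst hy; exact hT

theorem Reach.pos {V : Type*} {G : GameGraph V} {T : Set V} {π0 : List V → V → PMF V} {v : V}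
    (π1 : List V → V → PMF V) (N : ℕ)
    (hπ : ∀ (h : List V) (u x : V), h.length < N → x ∈ G.E u → π1 h u x ≠ 0)
    {h : List V} {u : V} (H : Reach G T π0 v h u) :
    h.length ≤ N → prefixProb G π0 π1 v (h ++ [u]) ≠ 0 := by
  induction H with
  | base => intro _; simp [prefixProb, extProb]
  | @step h u x _ hT h0 h1 ih =>
    intro hN
    simp at hN
    rw [prefixProb_snoc]
    refine mul_ne_zero (ih (by omega)) ?_
    unfold stepProb
    split_ifs with a b c
    · exact (PMF.mem_support_iff _ _).1 (h0 a)
    · exact hπ _ _ _ (by omega) (h1 a)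
    · exact ENNReal.inv_ne_zero.2 (ENNReal.natCast_ne_top _)
    · exact absurd (h1 a) c

theorem mem_cyl_range {V : Type*} (r : ℕ → V) (n : ℕ) : r ∈ cyl ((List.range n).map r) := by
  intro i; simp

theorem range_of_mem_cyl {V : Type*} {r : ℕ → V} {l : List V} (hr : r ∈ cyl l) :
    (List.range l.length).map r = l := by
  apply List.ext_getElem
  · simp
  · intro i h1 h2
    simpa using hr ⟨i, h2⟩

theorem measurableSet_cyl {V : Type*} [MeasurableSpace V] [MeasurableSingletonClass V]
    (l : List V) : MeasurableSet (cyl l) := by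
  have : cyl l = ⋂ i : Fin l.length, (fun r : ℕ → V => r i) ⁻¹' {l.get i} := by
    ext r; simp [cyl]
  rw [this]
  exact MeasurableSet.iInter fun i => measurable_pi_apply _ (measurableSet_singleton _)

open scoped Classical in
theorem exists_spoiler {V : Type*} [Finite V] (G : GameGraph V) (hG : G.IsGameGraph)
    (A : Set V) (N : ℕ) : ∃ π1 : List V → V → PMF V, IsStrategy G π1 ∧
      (∀ (h : List V) (u x : V), h.length < N → x ∈ G.E u → π1 h u x ≠ 0) ∧
      (∀ (h : List V) (u x : V), N ≤ h.length → ¬ G.E u ⊆ A → π1 h u x ≠ 0 → x ∉ A) := by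
  have hg : ∀ v, ∃ x ∈ G.E v, ¬ G.E v ⊆ A → x ∉ A := by
    intro v
    by_cases hv : G.E v ⊆ A
    · obtain ⟨x, hx⟩ := hG.1 v
      exact ⟨x, hx, fun h => absurd hv h⟩
    · obtain ⟨x, hx, hxA⟩ := Set.not_subset.1 hv
      exact ⟨x, hx, fun _ => hxA⟩
  choose g hgE hgA using hg
  have hne : ∀ v, (Set.toFinite (G.E v)).toFinset.Nonempty := fun v => by
    simpa using hG.1 v
  refine ⟨fun h v => if h.length < N then PMF.uniformOfFinset _ (hne v) else PMF.pure (g v),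
    ?_, ?_, ?_⟩
  · intro h v x hx
    dsimp only at hx
    split_ifs at hx with hN
    · simpa using hx
    · simp at hx; subst hx; exact hgE v
  · intro h u x hN hx
    dsimp only
    rw [if_pos hN]
    exact (PMF.mem_support_iff _ _).1 (by simpa using hx)
  · intro h u x hN hA hx
    dsimp only at hx
    rw [if_neg (by omega)] at hx
    have : x ∈ (PMF.pure (g u)).support := (PMF.mem_support_iff _ _).2 hx
    simp at this; subst this; exact hgA u hA

/-- Let `G` be a 2½-player game graph and `B, T ⊆ V`. Let `Y*` be the value
of the nested fixpoint `νY. μX. (Bᶜ ∩ Apre(Y, X)) ∪ (B ∩ Cpre(Y)) ∪ T`. Then every vertex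
`v ∈ V` for which there exists `π0 ∈ Π0` such that for all `π1 ∈ Π1`,
`P_v^{π0,π1}((□◇B) ∪ (◇T)) = 1`, belongs to `Y*`. -/
theorem stmt5
    {V : Type*} [Finite V] [MeasurableSpace V] [MeasurableSingletonClass V]
    (G : GameGraph V) (hG : G.IsGameGraph)
    (B T : Set V)
    -- the family of run measures `P_v^{π0,π1}` (Ionescu–Tulcea)
    (RunM : (List V → V → PMF V) → (List V → V → PMF V) → V → Measure (ℕ → V))
    (hRunM : ∀ π0 π1, IsStrategy G π0 → IsStrategy G π1 →
      ∀ v : V, IsRunMeasure G π0 π1 v (RunM π0 π1 v))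
    -- the nested fixpoint `Y*`
    (Ystar : Set V)
    (hYstar : Ystar = gfpSet (fun Y => lfpSet (fun X =>
      (Bᶜ ∩ Apre G Y X) ∪ (B ∩ Cpre G Y) ∪ T))) :
    ∀ v : V,
      (∃ π0 : List V → V → PMF V, IsStrategy G π0 ∧
        ∀ π1 : List V → V → PMF V, IsStrategy G π1 →
          RunM π0 π1 v ({r | {k | r k ∈ B}.Infinite} ∪ {r | ∃ k : ℕ, r k ∈ T}) = 1) →
      v ∈ Ystar := by
  intro v ⟨π0, hπ0, hwin⟩
  have hU := hG.2.1
  set W : Set V := {u | ∃ h, Reach G T π0 v h u} with hW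
  suffices hsub : W ⊆ Ystar from hsub ⟨[], Reach.base⟩
  rw [hYstar]
  refine le_sSup (a := W) ?_
  show W ⊆ sInf _
  refine le_sInf ?_
  intro A hA u hu
  by_contra huA
  -- successors of vertices in `W` outside `T`
  have hW0 : ∀ w ∈ W, w ∉ T → w ∈ Cpre G W := by
    rintro w ⟨h, hw⟩ hT
    by_cases h0 : w ∈ G.V0
    · left
      obtain ⟨x, hx⟩ := (π0 h w).support_nonempty
      exact ⟨h0, x, hπ0 h w hx, _, hw.step hT (fun _ => hx) (fun h => absurd h0 h)⟩
    · right
      refine ⟨?_, fun x hx => ⟨_, hw.step hT (fun h => absurd h h0) (fun _ => hx)⟩⟩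
      have : w ∈ G.V0 ∪ G.V1 ∪ G.Vr := hU ▸ Set.mem_univ w
      rcases this with (h | h) | h
      · exact absurd h h0
      · exact Or.inl h
      · exact Or.inr h
  have key : ∀ w ∈ W, w ∉ A → w ∉ T ∧ w ∉ B ∧ w ∉ Apre G W A := by
    intro w hw hwA
    have hT : w ∉ T := fun h => hwA (hA (Or.inr h))
    have hB : w ∉ B := fun h => hwA (hA (Or.inl (Or.inr ⟨h, hW0 w hw hT⟩)))
    exact ⟨hT, hB, fun h => hwA (hA (Or.inl (Or.inl ⟨hB, h⟩)))⟩
  obtain ⟨h, hh⟩ := hu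
  obtain ⟨π1, hπ1, hpos, hstay⟩ := exists_spoiler G hG A h.length
  have hp : prefixProb G π0 π1 v (h ++ [u]) ≠ 0 := hh.pos π1 _ hpos le_rfl
  obtain ⟨hprob, hcyl⟩ := hRunM π0 π1 hπ0 hπ1 v
  have hwin1 := hwin π1 hπ1
  set P := RunM π0 π1 v with hP
  set Win : Set (ℕ → V) := {r | {k | r k ∈ B}.Infinite} ∪ {r | ∃ k : ℕ, r k ∈ T} with hWin
  set N : Set (ℕ → V) := ⋃ L : {L : List V // prefixProb G π0 π1 v L = 0}, cyl L.1 with hN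
  have hN0 : P N = 0 := by
    have : Countable V := Finite.to_countable
    refine measure_iUnion_null fun L => ?_
    rw [hcyl]; exact L.2
  have hinc : Win ⊆ N ∪ (cyl (h ++ [u]))ᶜ := by
    intro r hr
    by_contra hcon
    simp only [Set.mem_union, not_or, Set.mem_compl_iff, not_not] at hcon
    obtain ⟨hrN, hrc⟩ := hcon
    have hposr : ∀ n, prefixProb G π0 π1 v ((List.range n).map r) ≠ 0 := by
      intro n hn
      exact hrN (Set.mem_iUnion.2 ⟨⟨_, hn⟩, mem_cyl_range r n⟩)
    have hpre := range_of_mem_cyl hrc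
    rw [List.length_append, List.length_singleton, List.range_succ, List.map_append,
      List.map_singleton] at hpre
    obtain ⟨hpre1, hpre2⟩ := List.append_inj' hpre rfl
    simp only [List.cons.injEq, and_true] at hpre2
    have inv : ∀ n, h.length ≤ n →
        Reach G T π0 v ((List.range n).map r) (r n) ∧ r n ∉ A := by
      intro n hn
      induction n, hn using Nat.le_induction with
      | base => rw [hpre1, hpre2]; exact ⟨hh, huA⟩
      | succ n hn ih =>
        obtain ⟨ihR, ihA⟩ := ih
        obtain ⟨kT, kB, kA⟩ := key _ ⟨_, ihR⟩ ihA
        have h2 := hposr (n + 2)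
        rw [List.range_succ, List.range_succ, List.map_append, List.map_append,
          List.map_singleton, List.map_singleton, prefixProb_snoc] at h2
        have hs := right_ne_zero_of_mul h2
        rw [List.range_succ, List.map_append, List.map_singleton]
        unfold stepProb at hs
        split_ifs at hs with a b c
        · have hx : r (n + 1) ∈ (π0 ((List.range n).map r) (r n)).support :=
            (PMF.mem_support_iff _ _).2 hs
          refine ⟨ihR.step kT (fun _ => hx) (fun h => absurd a h), fun hxA => kA ?_⟩
          exact Or.inl (Or.inl ⟨a, _, hπ0 _ _ hx, hxA⟩)
        · have hx : r (n + 1) ∈ (π1 ((List.range n).map r) (r n)).support :=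
            (PMF.mem_support_iff _ _).2 hs
          refine ⟨ihR.step kT (fun h => absurd h a) (fun _ => hπ1 _ _ hx), ?_⟩
          refine hstay _ _ _ (by simpa using hn) (fun hsub => kA ?_) hs
          exact Or.inl (Or.inr ⟨Or.inl b, hsub⟩)
        · have hr' : r n ∈ G.Vr := by
            have : r n ∈ G.V0 ∪ G.V1 ∪ G.Vr := hU ▸ Set.mem_univ (r n)
            rcases this with (h | h) | h
            · exact absurd h a
            · exact absurd h b
            · exact h
          refine ⟨ihR.step kT (fun h => absurd h a) (fun _ => c), fun hxA => kA ?_⟩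
          refine Or.inr ⟨hr', fun y hy => ?_, _, c, hxA⟩
          exact ⟨_, ihR.step kT (fun h => absurd h a) (fun _ => hy)⟩
        · exact absurd rfl hs
    rcases hr with hr | ⟨k, hk⟩
    · apply hr
      refine (Set.finite_lt_nat h.length).subset fun k hk => ?_
      by_contra hlt
      have := inv k (not_lt.1 hlt)
      exact (key _ ⟨_, this.1⟩ this.2).2.1 hk
    · by_cases hlt : k < h.length
      · refine hh.notMem (r k) ?_ hk
        rw [← hpre1]
        exact List.mem_map.2 ⟨k, List.mem_range.2 hlt, rfl⟩
      · have := inv k (not_lt.1 hlt)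
        exact (key _ ⟨_, this.1⟩ this.2).1 hk
  have hle : (1 : ℝ≥0∞) ≤ P (cyl (h ++ [u]))ᶜ := by
    calc (1 : ℝ≥0∞) = P Win := hwin1.symm
      _ ≤ P (N ∪ (cyl (h ++ [u]))ᶜ) := measure_mono hinc
      _ ≤ P N + P (cyl (h ++ [u]))ᶜ := measure_union_le _ _
      _ = P (cyl (h ++ [u]))ᶜ := by rw [hN0, zero_add]
  have h0 : P (cyl (h ++ [u])) = 0 := by
    refine (prob_compl_eq_one_iff (measurableSet_cyl _)).1 (le_antisymm prob_le_one hle)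
  rw [hcyl] at h0
  exact hp h0
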